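/- Fix probability vectors p = (p_w, p_d, p_ℓ) and q = (q_w, q_d, q_ℓ). If both styles are strictly losing, i.e. p_w < p_ℓ and q_w < q_ℓ, then the optimal gain converges to the worst possible value: g*_N → −1 as N → ∞. -/

import Mathlib

noncomputable section

open Filter Topology Finset

/-- The sign of an integer score, as a real number (`sgn 0 = 0`). -/
def sgn (x : ℤ) : ℝ := if 0 < x then 1 else if x < 0 then -1 else 0

/-- Expected sign of the score after one more game played with win/draw/loss
probabilities `w, d, l`, starting from score `x`. -/
def stepVal (w d l : ℝ) (x : ℤ) : ℝ := w * sgn (x + 1) + d * sgn x + l * sgn (x - 1)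

/-- Bellman value function with `k` games remaining: `bellman p q k x = V_{N-k}^N(x)`.
With no game remaining the value is the sign of the score; otherwise Player 1 picks the
better of the offensive style `(pw, pd, pl)` and the defensive style `(qw, qd, ql)`. -/
def bellman (pw pd pl qw qd ql : ℝ) : ℕ → ℤ → ℝ
  | 0, x => sgn x
  | k + 1, x =>
      max
        (pw * bellman pw pd pl qw qd ql k (x + 1) + pd * bellman pw pd pl qw qd ql k x +
          pl * bellman pw pd pl qw qd ql k (x - 1))
        (qw * bellman pw pd pl qw qd ql k (x + 1) + qd * bellman pw pd pl qw qd ql k x +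
          ql * bellman pw pd pl qw qd ql k (x - 1))

/-- Optimal gain over `N` games: `g*_N = V_0^N(0)`. -/
def gOpt (pw pd pl qw qd ql : ℝ) (N : ℕ) : ℝ := bellman pw pd pl qw qd ql N 0

/-- The two playing styles of Player 1. -/
inductive Style
  | offense
  | defense
deriving DecidableEq

/-- Selects the probability attached to a style: `a` for offense, `b` for defense. -/
def styleP (a b : ℝ) : Style → ℝ
  | .offense => a
  | .defense => b

/-- Probability mass function of the score process `X_n` under the policy `π`
(playing `π n x` at round `n+1` when the current score is `x`), started at `X_0 = 0`. -/
def polDist (pw pd pl qw qd ql : ℝ) (π : ℕ → ℤ → Style) : ℕ → ℤ → ℝ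
  | 0, x => if x = 0 then 1 else 0
  | n + 1, x =>
      polDist pw pd pl qw qd ql π n (x - 1) * styleP pw qw (π n (x - 1)) +
      polDist pw pd pl qw qd ql π n x * styleP pd qd (π n x) +
      polDist pw pd pl qw qd ql π n (x + 1) * styleP pl ql (π n (x + 1))

/-- Gain of policy `π` over `n` games: `g_n^π = E[sign (X_n)]`. -/
def gPol (pw pd pl qw qd ql : ℝ) (π : ℕ → ℤ → Style) (n : ℕ) : ℝ :=
  ∑' x : ℤ, polDist pw pd pl qw qd ql π n x * sgn x

/-- Probability mass function of the pair (score, switched-to-defense flag) under the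
catenaccio policy: play offense until the score first reaches `+1`, then defense forever. -/
def catDist (pw pd pl qw qd ql : ℝ) : ℕ → ℤ → Bool → ℝ
  | 0, x, b => if x = 0 ∧ b = false then 1 else 0
  | n + 1, x, true =>
      catDist pw pd pl qw qd ql n (x - 1) true * qw +
      catDist pw pd pl qw qd ql n x true * qd +
      catDist pw pd pl qw qd ql n (x + 1) true * ql +
      (if x = 1 then
        catDist pw pd pl qw qd ql n 0 false * pw +
        catDist pw pd pl qw qd ql n 1 false * pd +
        catDist pw pd pl qw qd ql n 2 false * pl
       else 0)
  | n + 1, x, false =>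
      if x = 1 then 0
      else
        catDist pw pd pl qw qd ql n (x - 1) false * pw +
        catDist pw pd pl qw qd ql n x false * pd +
        catDist pw pd pl qw qd ql n (x + 1) false * pl

/-- Gain of the catenaccio policy over `N` games: `g_N^(cat) = E[sign (X_N)]`. -/
def gCat (pw pd pl qw qd ql : ℝ) (N : ℕ) : ℝ :=
  ∑' x : ℤ,
    (catDist pw pd pl qw qd ql N x false + catDist pw pd pl qw qd ql N x true) * sgn x

/-- Gain of the catenaccio+ policy over `N` games: play catenaccio, except that if the
score after `N - 1` games is `0`, the last game is played with the better of the two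
styles (offense if `pw - pl > qw - ql`, defense otherwise). -/
def gCatPlus (pw pd pl qw qd ql : ℝ) : ℕ → ℝ
  | 0 => 0
  | N + 1 =>
      ∑' x : ℤ,
        (catDist pw pd pl qw qd ql N x false *
            (if x = 0 then (if pw - pl > qw - ql then pw - pl else qw - ql)
             else stepVal pw pd pl x) +
          catDist pw pd pl qw qd ql N x true *
            (if x = 0 then (if pw - pl > qw - ql then pw - pl else qw - ql)
             else stepVal qw qd ql x))

/-- Probability mass function of the lazy random walk with i.i.d. increments (+1 with
probability `qw`, 0 with probability `qd`, −1 with probability `ql`), started at `0`. -/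
def walkDist (qw qd ql : ℝ) : ℕ → ℤ → ℝ
  | 0, x => if x = 0 then 1 else 0
  | n + 1, x =>
      walkDist qw qd ql n (x - 1) * qw + walkDist qw qd ql n x * qd +
        walkDist qw qd ql n (x + 1) * ql

/-- Fixed-style gain over `N` games for the walk with step law `(qw, qd, ql)`. -/
def gFixed (qw qd ql : ℝ) (N : ℕ) : ℝ := ∑' x : ℤ, walkDist qw qd ql N x * sgn x

/-- Probability mass function of the lazy random walk with step law `(pw, pd, pl)`,
started at `0` and absorbed (stopped) at the level `+1`.  In particular
`stoppedDist pw pd pl n 1` is the probability that the walk reaches `+1` by time `n`. -/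
def stoppedDist (pw pd pl : ℝ) : ℕ → ℤ → ℝ
  | 0, x => if x = 0 then 1 else 0
  | n + 1, x =>
      if x = 1 then
        stoppedDist pw pd pl n 1 + stoppedDist pw pd pl n 0 * pw +
          stoppedDist pw pd pl n 2 * pl
      else
        (if x - 1 = 1 then 0 else stoppedDist pw pd pl n (x - 1) * pw) +
          stoppedDist pw pd pl n x * pd +
          (if x + 1 = 1 then 0 else stoppedDist pw pd pl n (x + 1) * pl)

/-- A strictly losing step law has an exponential moment below one at every base `1 + t` with
`t > 0` small enough. -/
lemma exp_moment_lt_one {w d l t : ℝ} (hw : 0 ≤ w) (hd : 0 ≤ d) (hsum : w + d + l = 1)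
    (hlose : w < l) (ht : 0 < t) (htle : t ≤ (l - w) / 2) :
    w * (1 + t) + d + l * (1 + t)⁻¹ < 1 := by
  have hr : 0 < 1 + t := by linarith
  have hlt : w * (1 + t) < l := by nlinarith
  have hkey : w * (1 + t) + d + l * (1 + t)⁻¹ - 1 = t * (w * (1 + t) - l) * (1 + t)⁻¹ := by
    have hd' : d = 1 - w - l := by linarith
    subst hd'
    field_simp
    ring
  have hneg : t * (w * (1 + t) - l) * (1 + t)⁻¹ < 0 :=
    mul_neg_of_neg_of_pos (mul_neg_of_pos_of_neg ht (by linarith)) (inv_pos.2 hr)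
  linarith

lemma neg_one_le_sgn (x : ℤ) : -1 ≤ sgn x := by
  unfold sgn
  split_ifs <;> norm_num

lemma sgn_le_exp {r : ℝ} (hr : 1 ≤ r) (x : ℤ) : sgn x ≤ -1 + 2 * r ^ x := by
  have hpos : 0 < r ^ x := zpow_pos (by linarith) x
  unfold sgn
  split_ifs with h₁ h₂
  · linarith [one_le_zpow₀ hr h₁.le]
  · linarith
  · linarith [one_le_zpow₀ hr (not_lt.1 h₂)]

lemma neg_one_le_bellman {pw pd pl qw qd ql : ℝ}
    (hpw : 0 ≤ pw) (hpd : 0 ≤ pd) (hpl : 0 ≤ pl) (hp : pw + pd + pl = 1) (k : ℕ) (x : ℤ) :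
    -1 ≤ bellman pw pd pl qw qd ql k x := by
  induction k generalizing x with
  | zero => exact neg_one_le_sgn x
  | succ k ih =>
    refine le_max_of_le_left ?_
    linarith [mul_le_mul_of_nonneg_left (ih (x + 1)) hpw, mul_le_mul_of_nonneg_left (ih x) hpd,
      mul_le_mul_of_nonneg_left (ih (x - 1)) hpl]

/-- One step of a law whose exponential moment is at most `ρ` preserves an exponential bound,
up to the factor `ρ`. -/
lemma step_le_exp {w d l r ρ c : ℝ} (hw : 0 ≤ w) (hd : 0 ≤ d) (hl : 0 ≤ l)
    (hsum : w + d + l = 1) (hr : 0 < r) (hρ : w * r + d + l * r⁻¹ ≤ ρ) (hc : 0 ≤ c)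
    {f : ℤ → ℝ} (hf : ∀ x, f x ≤ -1 + c * r ^ x) (x : ℤ) :
    w * f (x + 1) + d * f x + l * f (x - 1) ≤ -1 + c * ρ * r ^ x := by
  have hup := hf (x + 1)
  have hdown := hf (x - 1)
  rw [zpow_add_one₀ hr.ne'] at hup
  rw [zpow_sub_one₀ hr.ne'] at hdown
  have hmoment := mul_le_mul_of_nonneg_left hρ (mul_nonneg hc (zpow_pos hr x).le)
  linarith [mul_le_mul_of_nonneg_left hup hw, mul_le_mul_of_nonneg_left (hf x) hd,
    mul_le_mul_of_nonneg_left hdown hl]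

lemma bellman_le_exp {pw pd pl qw qd ql r ρ : ℝ}
    (hpw : 0 ≤ pw) (hpd : 0 ≤ pd) (hpl : 0 ≤ pl) (hp : pw + pd + pl = 1)
    (hqw : 0 ≤ qw) (hqd : 0 ≤ qd) (hql : 0 ≤ ql) (hq : qw + qd + ql = 1)
    (hr : 1 ≤ r) (hρ₀ : 0 ≤ ρ) (hpρ : pw * r + pd + pl * r⁻¹ ≤ ρ)
    (hqρ : qw * r + qd + ql * r⁻¹ ≤ ρ) (k : ℕ) (x : ℤ) :
    bellman pw pd pl qw qd ql k x ≤ -1 + 2 * ρ ^ k * r ^ x := by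
  have hr₀ : 0 < r := by linarith
  induction k generalizing x with
  | zero => simpa [bellman] using sgn_le_exp hr x
  | succ k ih =>
    have hc : 0 ≤ 2 * ρ ^ k := by positivity
    rw [pow_succ, ← mul_assoc]
    exact max_le (step_le_exp hpw hpd hpl hp hr₀ hpρ hc ih x)
      (step_le_exp hqw hqd hql hq hr₀ hqρ hc ih x)

/-- If both styles are strictly losing (`pw < pl` and `qw < ql`), then
the optimal gain converges to `−1` as `N → ∞`. -/
theorem gOpt_tendsto_neg_one_of_strictly_losing
    (pw pd pl qw qd ql : ℝ)
    (hpw : 0 ≤ pw) (hpd : 0 ≤ pd) (hpl : 0 ≤ pl) (hp : pw + pd + pl = 1)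
    (hqw : 0 ≤ qw) (hqd : 0 ≤ qd) (hql : 0 ≤ ql) (hq : qw + qd + ql = 1)
    (hlosep : pw < pl) (hloseq : qw < ql) :
    Tendsto (fun N : ℕ => gOpt pw pd pl qw qd ql N) atTop (𝓝 (-1)) := by
  obtain ⟨t, ht, htp, htq⟩ : ∃ t : ℝ, 0 < t ∧ t ≤ (pl - pw) / 2 ∧ t ≤ (ql - qw) / 2 :=
    ⟨min ((pl - pw) / 2) ((ql - qw) / 2), lt_min (by linarith) (by linarith),
      min_le_left _ _, min_le_right _ _⟩
  have hr : 1 ≤ 1 + t := by linarith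
  obtain ⟨ρ, hpρ, hqρ, hρ₁⟩ : ∃ ρ : ℝ, pw * (1 + t) + pd + pl * (1 + t)⁻¹ ≤ ρ ∧
      qw * (1 + t) + qd + ql * (1 + t)⁻¹ ≤ ρ ∧ ρ < 1 :=
    ⟨_, le_max_left _ _, le_max_right _ _, max_lt (exp_moment_lt_one hpw hpd hp hlosep ht htp)
      (exp_moment_lt_one hqw hqd hq hloseq ht htq)⟩
  have hρ₀ : 0 ≤ ρ := le_trans (by positivity) hpρ
  have hlim : Tendsto (fun N : ℕ => -1 + 2 * ρ ^ N) atTop (𝓝 (-1)) := by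
    simpa using ((tendsto_pow_atTop_nhds_zero_of_lt_one hρ₀ hρ₁).const_mul 2).const_add (-1)
  refine tendsto_of_tendsto_of_tendsto_of_le_of_le tendsto_const_nhds hlim
    (fun N => neg_one_le_bellman hpw hpd hpl hp N 0) (fun N => ?_)
  simpa [gOpt] using
    bellman_le_exp hpw hpd hpl hp hqw hqd hql hq hr hρ₀ hpρ hqρ N 0
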